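/- arXiv:1904.03336 — 3 statements merged into one kernel-verified Lean document; each statement's English description precedes it below -/
import Mathlib

section
/- Let D be a quantitative database over a finite set of items I, and let X ⊆ X' ⊆ I be itemsets with X nonempty, such that sup({i}) > 0 for every i ∈ X', and such that sup({i}) ≤ sup({a}) for every i ∈ X and every a ∈ X' \ X. Then Kulc(X') ≤ Kulc(X). (Anti-monotonicity of Kulc along support-ascending extensions: in a support-ascending enumeration of patterns, the Kulc value of any descendant pattern is at most the Kulc value of the pattern itself.) -/
/-- The support of an itemset `X` in the quantitative database `D` with
quantity function `q`. -/
def supp {τ ι : Type*} (D : Finset τ) (q : τ → ι → ℕ) (X : Finset ι) : ℕ :=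
  (D.filter (fun c => ∀ i ∈ X, 0 < q c i)).card

/-- The Kulczynski measure of an itemset `X`:
`Kulc(X) = (1/|X|) * Σ_{i ∈ X} sup(X) / sup({i})`. -/
noncomputable def kulc {τ ι : Type*} (D : Finset τ) (q : τ → ι → ℕ) (X : Finset ι) : ℝ :=
  (1 / (X.card : ℝ)) * ∑ i ∈ X, (supp D q X : ℝ) / (supp D q {i} : ℝ)

theorem supp_anti {τ ι : Type*} (D : Finset τ) (q : τ → ι → ℕ) {X X' : Finset ι}
    (h : X ⊆ X') : supp D q X' ≤ supp D q X :=
  Finset.card_le_card <| Finset.monotone_filter_right D fun _ _ hc i hi => hc i (h hi)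

/-- Adjoining terms that are at most every given term does not increase the average. -/
theorem average_le_average_of_subset {ι : Type*} [DecidableEq ι] {X X' : Finset ι} {f : ι → ℝ}
    (h : X ⊆ X') (hX : X.Nonempty) (hf : ∀ i ∈ X, ∀ a ∈ X' \ X, f a ≤ f i) :
    (1 / (X'.card : ℝ)) * ∑ i ∈ X', f i ≤ (1 / (X.card : ℝ)) * ∑ i ∈ X, f i := by
  have hX0 : (0 : ℝ) < X.card := by exact_mod_cast hX.card_pos
  have hX0' : (0 : ℝ) < X'.card := by exact_mod_cast (hX.mono h).card_pos
  have hcard : ((X' \ X).card : ℝ) + X.card = X'.card := by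
    exact_mod_cast Finset.card_sdiff_add_card_eq_card h
  have hdouble : (X.card : ℝ) * ∑ a ∈ X' \ X, f a ≤ (X' \ X).card * ∑ i ∈ X, f i := by
    calc (X.card : ℝ) * ∑ a ∈ X' \ X, f a = ∑ i ∈ X, ∑ a ∈ X' \ X, f a := by simp
      _ ≤ ∑ i ∈ X, ∑ a ∈ X' \ X, f i :=
        Finset.sum_le_sum fun i hi => Finset.sum_le_sum fun a ha => hf i hi a ha
      _ = (X' \ X).card * ∑ i ∈ X, f i := by simp [Finset.mul_sum]
  rw [one_div_mul_eq_div, one_div_mul_eq_div, div_le_div_iff₀ hX0' hX0,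
    ← Finset.sum_sdiff h, ← hcard]
  linarith

/-- Anti-monotonicity of Kulc along support-ascending extensions: if `X ⊆ X'`,
`X` is nonempty, all singleton supports in `X'` are positive, and every item of
`X' \ X` has support at least the support of every item of `X`, then
`Kulc(X') ≤ Kulc(X)`. -/
theorem kulc_anti_monotone_support_ascending {τ ι : Type*} [DecidableEq ι]
    (D : Finset τ) (q : τ → ι → ℕ) (X X' : Finset ι)
    (hXX' : X ⊆ X') (hX : X.Nonempty)
    (hpos : ∀ i ∈ X', 0 < supp D q {i})
    (hle : ∀ i ∈ X, ∀ a ∈ X' \ X, supp D q {i} ≤ supp D q {a}) :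
    kulc D q X' ≤ kulc D q X := by
  calc kulc D q X'
      ≤ (1 / (X'.card : ℝ)) * ∑ i ∈ X', (supp D q X : ℝ) / (supp D q {i} : ℝ) := by
        unfold kulc
        gcongr
        exact supp_anti D q hXX'
    _ ≤ kulc D q X := by
        refine average_le_average_of_subset hXX' hX fun i hi a ha => ?_
        have hi0 : (0 : ℝ) < supp D q {i} := by exact_mod_cast hpos i (hXX' hi)
        have := hle i hi a ha
        gcongr
end

section
/- Anti-monotonicity of the upper bound on utility: let D be a quantitative database over a finite set of items I with nonnegative unit profits, fix a strict total order ≺ on I, and let X' be an extension of an itemset X. Then u(X') + RU(X') ≤ u(X) + RU(X); that is, the sum of total utility and total remaining utility never increases when passing from a pattern to any of its extensions. -/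
/-- The utility of an itemset `X` in a transaction `c`:
`u(X,c) = Σ_{i ∈ X} pr(i) * q(c,i)`. -/
def setUtil {τ ι : Type*} (q : τ → ι → ℕ) (pr : ι → ℝ) (X : Finset ι) (c : τ) : ℝ :=
  ∑ i ∈ X, pr i * (q c i : ℝ)

/-- The total utility of an itemset `X` in a database `D`:
the sum of `u(X,c)` over the transactions `c ∈ D` containing `X`. -/
def totalUtil {τ ι : Type*} (D : Finset τ) (q : τ → ι → ℕ) (pr : ι → ℝ)
    (X : Finset ι) : ℝ :=
  ∑ c ∈ D.filter (fun c => ∀ i ∈ X, 0 < q c i), setUtil q pr X c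

/-- The remaining utility of `X` in transaction `c`: the sum of the utilities
of the items of `T_c` that are not in `X` and come after every item of `X` in
the fixed strict total order on items. -/
def ru {τ ι : Type*} [Fintype ι] [LinearOrder ι] (q : τ → ι → ℕ) (pr : ι → ℝ)
    (X : Finset ι) (c : τ) : ℝ :=
  ∑ i ∈ Finset.univ.filter (fun i => 0 < q c i ∧ i ∉ X ∧ ∀ x ∈ X, x < i),
    pr i * (q c i : ℝ)

/-- The total remaining utility of `X`: the sum of `ru(X,c)` over the
transactions `c ∈ D` containing `X`. -/
def totalRU {τ ι : Type*} [Fintype ι] [LinearOrder ι] (D : Finset τ)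
    (q : τ → ι → ℕ) (pr : ι → ℝ) (X : Finset ι) : ℝ :=
  ∑ c ∈ D.filter (fun c => ∀ i ∈ X, 0 < q c i), ru q pr X c

/-- `X'` is an extension of `X` if `X ⊆ X'` and every item of `X' \ X` comes
after every item of `X` in the fixed strict total order on items. -/
def IsExtension {ι : Type*} [LinearOrder ι] (X X' : Finset ι) : Prop :=
  X ⊆ X' ∧ ∀ x ∈ X, ∀ a ∈ X' \ X, x < a

/-- `u(X,c) + ru(X,c)` as a single sum of item utilities over a disjoint union. -/
theorem setUtil_add_ru_eq_sum {τ ι : Type*} [Fintype ι] [LinearOrder ι]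
    (q : τ → ι → ℕ) (pr : ι → ℝ) (X : Finset ι) (c : τ) :
    setUtil q pr X c + ru q pr X c =
      ∑ i ∈ X ∪ Finset.univ.filter (fun i => 0 < q c i ∧ i ∉ X ∧ ∀ x ∈ X, x < i),
        pr i * (q c i : ℝ) := by
  rw [setUtil, ru, Finset.sum_union]
  exact Finset.disjoint_left.2 fun i hi h => (Finset.mem_filter.1 h).2.2.1 hi

theorem setUtil_add_ru_nonneg {τ ι : Type*} [Fintype ι] [LinearOrder ι]
    (q : τ → ι → ℕ) (pr : ι → ℝ) (hpr : ∀ i, 0 ≤ pr i) (X : Finset ι) (c : τ) :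
    0 ≤ setUtil q pr X c + ru q pr X c := by
  rw [setUtil_add_ru_eq_sum]
  exact Finset.sum_nonneg fun i _ => mul_nonneg (hpr i) (Nat.cast_nonneg _)

/-- Anti-monotonicity of the upper bound within a single transaction containing `X'`. -/
theorem setUtil_add_ru_extension_le {τ ι : Type*} [Fintype ι] [LinearOrder ι]
    (q : τ → ι → ℕ) (pr : ι → ℝ) (hpr : ∀ i, 0 ≤ pr i) {X X' : Finset ι}
    (hext : IsExtension X X') {c : τ} (hc : ∀ i ∈ X', 0 < q c i) :
    setUtil q pr X' c + ru q pr X' c ≤ setUtil q pr X c + ru q pr X c := by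
  obtain ⟨hsub, hlt⟩ := hext
  rw [setUtil_add_ru_eq_sum, setUtil_add_ru_eq_sum]
  refine Finset.sum_le_sum_of_subset_of_nonneg ?_
    fun i _ _ => mul_nonneg (hpr i) (Nat.cast_nonneg _)
  intro i hi
  simp only [Finset.mem_union, Finset.mem_filter, Finset.mem_univ, true_and] at hi ⊢
  by_cases hX : i ∈ X
  · exact Or.inl hX
  rcases hi with hi | ⟨hq, -, h⟩
  · exact Or.inr ⟨hc i hi, hX, fun x hx => hlt x hx i (Finset.mem_sdiff.2 ⟨hi, hX⟩)⟩
  · exact Or.inr ⟨hq, hX, fun x hx => h x (hsub hx)⟩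

theorem totalUtil_add_totalRU_eq_sum {τ ι : Type*} [Fintype ι] [LinearOrder ι]
    (D : Finset τ) (q : τ → ι → ℕ) (pr : ι → ℝ) (X : Finset ι) :
    totalUtil D q pr X + totalRU D q pr X =
      ∑ c ∈ D.filter (fun c => ∀ i ∈ X, 0 < q c i), (setUtil q pr X c + ru q pr X c) := by
  rw [Finset.sum_add_distrib, totalUtil, totalRU]
  congr!

/-- Anti-monotonicity of the upper bound on utility:
`u(X') + RU(X') ≤ u(X) + RU(X)` for any extension `X'` of `X`. -/
theorem totalUtil_add_totalRU_extension_le {τ ι : Type*} [Fintype ι] [LinearOrder ι]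
    (D : Finset τ) (q : τ → ι → ℕ) (pr : ι → ℝ) (hpr : ∀ i, 0 ≤ pr i)
    (X X' : Finset ι) (hext : IsExtension X X') :
    totalUtil D q pr X' + totalRU D q pr X' ≤
      totalUtil D q pr X + totalRU D q pr X := by
  rw [totalUtil_add_totalRU_eq_sum, totalUtil_add_totalRU_eq_sum]
  refine (Finset.sum_le_sum fun c hc =>
    setUtil_add_ru_extension_le q pr hpr hext (Finset.mem_filter.1 hc).2).trans ?_
  exact Finset.sum_le_sum_of_subset_of_nonneg
    (Finset.monotone_filter_right D fun c _ h i hi => h i (hext.1 hi))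
    fun c _ _ => setUtil_add_ru_nonneg q pr hpr X c
end

section
/- LA-Prune bound: let D be a quantitative database over a finite set of items I with nonnegative unit profits, fix a strict total order ≺ on I, let X be an itemset, and let y ∈ I \ X be an item with x ≺ y for every x ∈ X. Then for every extension X' of X with y ∈ X', u(X') ≤ (u(X) + RU(X)) − Σ_{c ∈ D : X ⊆ T_c and y ∉ T_c} (u(X,c) + ru(X,c)). Consequently, if the right-hand side is less than a utility threshold minUtil, then no extension of X containing y has utility at least minUtil. -/
theorem setUtil_nonneg {τ ι : Type*} {q : τ → ι → ℕ} {pr : ι → ℝ}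
    (hpr : ∀ i, 0 ≤ pr i) (X : Finset ι) (c : τ) : 0 ≤ setUtil q pr X c :=
  Finset.sum_nonneg fun i _ => mul_nonneg (hpr i) (Nat.cast_nonneg _)

theorem ru_nonneg {τ ι : Type*} [Fintype ι] [LinearOrder ι] {q : τ → ι → ℕ} {pr : ι → ℝ}
    (hpr : ∀ i, 0 ≤ pr i) (X : Finset ι) (c : τ) : 0 ≤ ru q pr X c :=
  Finset.sum_nonneg fun i _ => mul_nonneg (hpr i) (Nat.cast_nonneg _)

/-- In a transaction containing an extension `X'` of `X`, the utility of `X'` is at most the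
utility of `X` plus its remaining utility. -/
theorem setUtil_le_setUtil_add_ru {τ ι : Type*} [Fintype ι] [LinearOrder ι]
    {q : τ → ι → ℕ} {pr : ι → ℝ} (hpr : ∀ i, 0 ≤ pr i) {X X' : Finset ι}
    (hX' : IsExtension X X') {c : τ} (hc : ∀ i ∈ X', 0 < q c i) :
    setUtil q pr X' c ≤ setUtil q pr X c + ru q pr X c := by
  unfold setUtil ru
  rw [← Finset.sum_sdiff hX'.1, add_comm]
  refine add_le_add_right (Finset.sum_le_sum_of_subset_of_nonneg ?_ fun i _ _ =>
    mul_nonneg (hpr i) (Nat.cast_nonneg _)) _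
  intro i hi
  have hi' := Finset.mem_sdiff.1 hi
  exact Finset.mem_filter.2
    ⟨Finset.mem_univ i, hc i hi'.1, hi'.2, fun x hx => hX'.2 x hx i hi⟩

/-- Removing the transactions without `y` from `u(X) + RU(X)` leaves the sum over the transactions
containing both `X` and `y`. -/
theorem totalUtil_add_totalRU_sub_sum {τ ι : Type*} [Fintype ι] [LinearOrder ι]
    (D : Finset τ) (q : τ → ι → ℕ) (pr : ι → ℝ) (X : Finset ι) (y : ι) :
    (totalUtil D q pr X + totalRU D q pr X) -
        ∑ c ∈ D.filter (fun c => (∀ i ∈ X, 0 < q c i) ∧ q c y = 0),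
          (setUtil q pr X c + ru q pr X c) =
      ∑ c ∈ D.filter (fun c => (∀ i ∈ X, 0 < q c i) ∧ q c y ≠ 0),
        (setUtil q pr X c + ru q pr X c) := by
  unfold totalUtil totalRU
  simp_rw [Finset.sum_filter]
  rw [← Finset.sum_add_distrib, ← Finset.sum_sub_distrib]
  refine Finset.sum_congr rfl fun c _ => ?_
  split_ifs <;> grind

/-- LA-Prune bound: if `y ∉ X` comes after every item of `X` in the order, then
for every extension `X'` of `X` containing `y`,
`u(X') ≤ (u(X) + RU(X)) − Σ_{c ∈ D : X ⊆ T_c ∧ y ∉ T_c} (u(X,c) + ru(X,c))`;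
consequently, if this bound is below a utility threshold `minUtil`, then no
extension of `X` containing `y` has utility at least `minUtil`. -/
theorem la_prune {τ ι : Type*} [Fintype ι] [LinearOrder ι]
    (D : Finset τ) (q : τ → ι → ℕ) (pr : ι → ℝ) (hpr : ∀ i, 0 ≤ pr i)
    (X : Finset ι) (y : ι) (hy : y ∉ X) (hyX : ∀ x ∈ X, x < y) :
    (∀ X' : Finset ι, IsExtension X X' → y ∈ X' →
      totalUtil D q pr X' ≤
        (totalUtil D q pr X + totalRU D q pr X) -
          ∑ c ∈ D.filter (fun c => (∀ i ∈ X, 0 < q c i) ∧ q c y = 0),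
            (setUtil q pr X c + ru q pr X c)) ∧
    (∀ minUtil : ℝ,
      (totalUtil D q pr X + totalRU D q pr X) -
          ∑ c ∈ D.filter (fun c => (∀ i ∈ X, 0 < q c i) ∧ q c y = 0),
            (setUtil q pr X c + ru q pr X c) < minUtil →
      ∀ X' : Finset ι, IsExtension X X' → y ∈ X' →
        totalUtil D q pr X' < minUtil) := by
  have bound : ∀ X' : Finset ι, IsExtension X X' → y ∈ X' →
      totalUtil D q pr X' ≤
        (totalUtil D q pr X + totalRU D q pr X) -
          ∑ c ∈ D.filter (fun c => (∀ i ∈ X, 0 < q c i) ∧ q c y = 0),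
            (setUtil q pr X c + ru q pr X c) := by
    intro X' hX' hyX'
    rw [totalUtil_add_totalRU_sub_sum]
    unfold totalUtil
    rw [Finset.sum_filter, Finset.sum_filter]
    refine Finset.sum_le_sum fun c _ => ?_
    by_cases hc : ∀ i ∈ X', 0 < q c i
    · rw [if_pos hc, if_pos ⟨fun i hi => hc i (hX'.1 hi), (hc y hyX').ne'⟩]
      exact setUtil_le_setUtil_add_ru hpr hX' hc
    · rw [if_neg hc]
      split_ifs
      · exact add_nonneg (setUtil_nonneg hpr X c) (ru_nonneg hpr X c)
      · exact le_rfl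
  exact ⟨bound, fun _ h X' hX' hyX' => (bound X' hX' hyX').trans_lt h⟩
end
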